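/- arXiv:1502.05303 — 3 statements merged into one kernel-verified Lean document; each statement's English description precedes it below -/
import Mathlib

section
/- Let T>0, let β:(0,T)→[0,∞) be integrable, and let 0 < ε < e^{−e}. Define α*:[0,T]→ℝ by α*(s) = exp( −exp( exp( log log log(1/ε) − 16e ∫₀ˢ β(r) dr ) ) ). Then α* is nondecreasing on [0,T], α*(0) = ε, and for every t ∈ [0,T] one has α*(t) = ε + 16e ∫₀ᵗ β(s) α*(s) log(1/α*(s)) log( log(1/α*(s)) ) ds. -/
open MeasureTheory Real Set

noncomputable section

theorem LipschitzOnWith.comp_absolutelyContinuousOnInterval {X Y : Type*}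
    [PseudoMetricSpace X] [PseudoMetricSpace Y] {K : NNReal} {φ : X → Y} {s : Set X} {f : ℝ → X}
    {a b : ℝ} (hφ : LipschitzOnWith K φ s) (hf : AbsolutelyContinuousOnInterval f a b)
    (hfs : MapsTo f (uIcc a b) s) :
    AbsolutelyContinuousOnInterval (fun x ↦ φ (f x)) a b := by
  rw [absolutelyContinuousOnInterval_iff] at hf ⊢
  intro ε hε
  obtain ⟨δ, hδ, h⟩ := hf (ε / (K + 1)) (by positivity)
  refine ⟨δ, hδ, fun E hE hEδ ↦ ?_⟩
  have hlt := h E hE hEδ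
  calc ∑ i ∈ Finset.range E.1, dist (φ (f (E.2 i).1)) (φ (f (E.2 i).2))
      ≤ ∑ i ∈ Finset.range E.1, (K + 1) * dist (f (E.2 i).1) (f (E.2 i).2) := by
        refine Finset.sum_le_sum fun i hi ↦ ?_
        have hd := hφ.dist_le_mul _ (hfs (hE.1 i hi).1) _ (hfs (hE.1 i hi).2)
        linarith [dist_nonneg (x := f (E.2 i).1) (y := f (E.2 i).2)]
    _ = (K + 1) * ∑ i ∈ Finset.range E.1, dist (f (E.2 i).1) (f (E.2 i).2) := by
        rw [Finset.mul_sum]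
    _ < ε := by rwa [lt_div_iff₀' (by positivity)] at hlt

/-- A `C¹` function of an absolutely continuous function is absolutely continuous. -/
theorem ContDiff.comp_absolutelyContinuousOnInterval {φ f : ℝ → ℝ} {a b : ℝ}
    (hφ : ContDiff ℝ 1 φ) (hf : AbsolutelyContinuousOnInterval f a b) :
    AbsolutelyContinuousOnInterval (fun x ↦ φ (f x)) a b := by
  obtain ⟨C, hC⟩ := hf.exists_bound
  obtain ⟨K, hK⟩ := (hφ.contDiffOn (s := Icc (-C) C)).exists_lipschitzOnWith (by decide)
    (convex_Icc _ _) isCompact_Icc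
  exact hK.comp_absolutelyContinuousOnInterval hf fun x hx ↦ abs_le.mp (hC x hx)

/-- Change of variables along the primitive of an integrable function. -/
theorem integral_mul_deriv_comp_primitive {φ β : ℝ → ℝ} {a b : ℝ} (hφ : ContDiff ℝ 1 φ)
    (hβ : IntervalIntegrable β volume a b) :
    ∫ s in a..b, β s * deriv φ (∫ r in a..s, β r) = φ (∫ r in a..b, β r) - φ 0 := by
  have hac := hφ.comp_absolutelyContinuousOnInterval
    (hβ.absolutelyContinuousOnInterval_intervalIntegral left_mem_uIcc)
  have h := hac.integral_deriv_eq_sub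
  rw [intervalIntegral.integral_same] at h
  rw [← h]
  refine intervalIntegral.integral_congr_ae ?_
  filter_upwards [hβ.ae_hasDerivAt_integral] with x hx hxm
  have hB := hx (uIoc_subset_uIcc hxm) a left_mem_uIcc
  rw [mul_comm]
  exact (((hφ.differentiable one_ne_zero _).hasDerivAt).comp x hB).deriv.symm

theorem hasDerivAt_exp_neg_exp_exp (L c x : ℝ) :
    HasDerivAt (fun x ↦ exp (-exp (exp (L - c * x))))
      (c * (exp (-exp (exp (L - c * x))) * exp (exp (L - c * x)) * exp (L - c * x))) x := by
  have h := ((((hasDerivAt_id x).const_mul c).const_sub L).exp.exp.neg).exp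
  convert! h using 1
  simp only [id, Pi.neg_apply]
  ring

/-- The explicit triple-exponential Gronwall comparison function:
α*(s) = exp(−exp(exp(log log log(1/ε) − 16e ∫₀ˢ β))) is nondecreasing, starts at ε,
and satisfies the integral identity
α*(t) = ε + 16e ∫₀ᵗ β(s) α*(s) log(1/α*(s)) log(log(1/α*(s))) ds. -/
theorem gronwall_triple_log
    (T : ℝ) (hT : 0 < T) (β : ℝ → ℝ)
    (hβint : IntegrableOn β (Ioo 0 T) volume)
    (hβpos : ∀ t ∈ Ioo 0 T, 0 ≤ β t)
    (ε : ℝ) (hε0 : 0 < ε) (hε1 : ε < Real.exp (-Real.exp 1))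
    (αs : ℝ → ℝ)
    (hαs : ∀ s, αs s =
      Real.exp (-Real.exp (Real.exp
        (Real.log (Real.log (Real.log (1 / ε)))
          - 16 * Real.exp 1 * ∫ r in Ioo 0 s, β r)))) :
    MonotoneOn αs (Icc 0 T) ∧ αs 0 = ε ∧
      ∀ t ∈ Icc 0 T,
        αs t = ε + 16 * Real.exp 1 *
          ∫ s in Ioo 0 t,
            β s * αs s * Real.log (1 / αs s) * Real.log (Real.log (1 / αs s)) := by
  set L := log (log (log (1 / ε)))
  set c := 16 * exp 1
  have hc : 0 < c := by positivity
  have hmono : MonotoneOn αs (Icc 0 T) := by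
    intro s hs t ht hst
    have hB : ∫ r in Ioo 0 s, β r ≤ ∫ r in Ioo 0 t, β r := by
      refine setIntegral_mono_set (hβint.mono_set (Ioo_subset_Ioo_right ht.2)) ?_
        (Ioo_subset_Ioo_right hst).eventuallyLE
      filter_upwards [ae_restrict_mem measurableSet_Ioo] with r hr
      exact hβpos r ⟨hr.1, hr.2.trans_le ht.2⟩
    rw [hαs, hαs]
    gcongr
  have hzero : αs 0 = ε := by
    have h1 : exp 1 < log (1 / ε) := by
      rw [one_div, log_inv, lt_neg]
      exact (log_lt_iff_lt_exp hε0).mpr hε1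
    have h2 : 1 < log (log (1 / ε)) :=
      (lt_log_iff_exp_lt ((exp_pos 1).trans h1)).mpr h1
    rw [hαs]
    simp only [Ioo_self, Measure.restrict_empty, integral_zero_measure, mul_zero, sub_zero, L]
    rw [exp_log (one_pos.trans h2), exp_log ((exp_pos 1).trans h1), one_div, log_inv, neg_neg,
      exp_log hε0]
  refine ⟨hmono, hzero, fun t ht ↦ ?_⟩
  have hprim (s : ℝ) (hs : 0 ≤ s) : ∫ r in Ioo 0 s, β r = ∫ r in 0..s, β r := by
    rw [intervalIntegral.integral_of_le hs, integral_Ioc_eq_integral_Ioo]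
  have hβ : IntervalIntegrable β volume 0 t :=
    (intervalIntegrable_iff_integrableOn_Ioo_of_le ht.1).mpr
      (hβint.mono_set (Ioo_subset_Ioo_right ht.2))
  have hderiv := fun x ↦ (hasDerivAt_exp_neg_exp_exp L c x).deriv
  have hφ : ContDiff ℝ 1 (fun x ↦ exp (-exp (exp (L - c * x)))) := by fun_prop
  have hFTC := integral_mul_deriv_comp_primitive hφ hβ
  have hε : exp (-exp (exp (L - c * 0))) = ε := by
    rw [← hzero, hαs]
    simp
  rw [hε, ← hprim t ht.1, ← hαs, intervalIntegral.integral_of_le ht.1,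
    integral_Ioc_eq_integral_Ioo] at hFTC
  rw [← integral_const_mul, ← sub_eq_iff_eq_add', ← hFTC]
  refine setIntegral_congr_fun measurableSet_Ioo fun s hs ↦ ?_
  simp only [hderiv]
  rw [hαs s, hprim s hs.1.le, one_div, log_inv, log_exp, neg_neg, log_exp]
  ring
end
end

section
/- Let F:ℝ→ℝ be continuous with F ≥ 0, let h:ℝ→ℝ be a C¹ homeomorphism of ℝ satisfying h'(s) = F(h(s)) for all s ∈ ℝ, and let φ:ℝ→ℝ be smooth. Define b̃:ℝ²→ℝ² by b̃(x₁,x₂) = (0, φ(x₁)·F(x₂)). Then for every (x₁,x₂) ∈ ℝ², the curve X:ℝ→ℝ² defined by X(t) = (x₁, h(t·φ(x₁) + h⁻¹(x₂))) satisfies X(0) = (x₁,x₂) and X'(t) = b̃(X(t)) for every t ∈ ℝ. -/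
open Real Function

noncomputable section

/-- The explicit flow of the autonomous planar field
b̃(x₁,x₂) = (0, φ(x₁)F(x₂)): for a C¹ homeomorphism h of ℝ with h' = F∘h, the curve
X(t) = (x₁, h(tφ(x₁) + h⁻¹(x₂))) solves X' = b̃(X), X(0) = (x₁,x₂). -/
theorem flow_of_diperna_lions_field
    (F : ℝ → ℝ) (hF : Continuous F) (hFpos : ∀ y, 0 ≤ F y)
    (h hinv : ℝ → ℝ) (hC1 : ContDiff ℝ 1 h)
    (hleft : LeftInverse hinv h) (hright : RightInverse hinv h)
    (hinvcont : Continuous hinv)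
    (hode : ∀ s, deriv h s = F (h s))
    (φ : ℝ → ℝ) (hφ : ContDiff ℝ (⊤ : ℕ∞) φ)
    (x₁ x₂ : ℝ) :
    (x₁, h (0 * φ x₁ + hinv x₂)) = (x₁, x₂) ∧
      ∀ t : ℝ, HasDerivAt (fun τ => (x₁, h (τ * φ x₁ + hinv x₂)))
        ((0 : ℝ), φ x₁ * F (h (t * φ x₁ + hinv x₂))) t := by
  refine ⟨by rw [zero_mul, zero_add, hright x₂], fun t => ?_⟩
  have hh : HasDerivAt h (F (h (t * φ x₁ + hinv x₂))) (t * φ x₁ + hinv x₂) := by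
    rw [← hode]
    exact (hC1.differentiable one_ne_zero _).hasDerivAt
  have hlin : HasDerivAt (fun τ : ℝ => τ * φ x₁ + hinv x₂) (φ x₁) t := by
    simpa using ((hasDerivAt_id t).mul_const (φ x₁)).add_const (hinv x₂)
  rw [mul_comm (φ x₁)]
  exact (hasDerivAt_const t x₁).prodMk (hh.comp t hlin)
end
end

section
/- Let T>0. Let F:ℝ→ℝ be continuous, bounded and nonnegative; let h:ℝ→ℝ be a C¹ homeomorphism of ℝ satisfying h'(s) = F(h(s)) for all s ∈ ℝ; let φ ∈ C_c^∞(ℝ) and u₀ ∈ C_c^∞(ℝ²). Define b̃:ℝ²→ℝ² by b̃(x₁,x₂) = (0, φ(x₁)·F(x₂)), and suppose D̃:ℝ²→ℝ is locally integrable with ∫_{ℝ²} b̃·∇ψ dx = −∫_{ℝ²} D̃ ψ dx for every ψ ∈ C_c^∞(ℝ²). Then the function u(t,x₁,x₂) := u₀(x₁, h(t·φ(x₁) + h⁻¹(x₂))) belongs to L^∞((0,T)×ℝ²) and is a weak solution of ∂ₜu − b̃·∇u = 0 with u(0,·) = u₀; that is, for every smooth φ̃:ℝ×ℝ²→ℝ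 with compact support contained in [0,T)×ℝ²: −∫₀ᵀ∫_{ℝ²} u ∂ₜφ̃ dx dt − ∫_{ℝ²} u₀ φ̃(0,·) dx + ∫₀ᵀ∫_{ℝ²} u (b̃·∇ₓφ̃ + D̃ φ̃) dx dt = 0. -/
open MeasureTheory Real Set Function
open scoped ENNReal

noncomputable section

/-- v·∇f at x, in the plane ℝ² = ℝ × ℝ -/
def dotGrad2 (v : ℝ × ℝ) (f : ℝ × ℝ → ℝ) (x : ℝ × ℝ) : ℝ :=
  v.1 * fderiv ℝ f x (1, 0) + v.2 * fderiv ℝ f x (0, 1)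

open Filter Topology Convolution Pointwise

theorem exists_contDiffBump_rOut_tendsto (E : Type*) [NormedAddCommGroup E] [NormedSpace ℝ E] :
    ∃ ρ : ℕ → ContDiffBump (0 : E), (∀ n, (ρ n).rOut ≤ 1) ∧
      Tendsto (fun n => (ρ n).rOut) atTop (𝓝 0) := by
  have hpos (n : ℕ) : (0 : ℝ) < 1 / ((n : ℝ) + 1) := by positivity
  refine ⟨fun n => ⟨1 / ((n : ℝ) + 1) / 2, 1 / ((n : ℝ) + 1), half_pos (hpos n),
    half_lt_self (hpos n)⟩, fun n => ?_, tendsto_one_div_add_atTop_nhds_zero_nat⟩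
  rw [div_le_one (by positivity)]
  linarith [(n.cast_nonneg : (0 : ℝ) ≤ n)]

section Mollification

variable {E : Type*} [NormedAddCommGroup E] [NormedSpace ℝ E] [FiniteDimensional ℝ E]
  [MeasurableSpace E] [BorelSpace E] {μ : Measure E} [μ.IsAddHaarMeasure]

theorem tendsto_integral_mul_normed_convolution {ρ : ℕ → ContDiffBump (0 : E)}
    (hρ1 : ∀ n, (ρ n).rOut ≤ 1) (hρ0 : Tendsto (fun n => (ρ n).rOut) atTop (𝓝 0))
    {w k : E → ℝ} (hw : LocallyIntegrable w μ) (hk : Continuous k) (hks : HasCompactSupport k) :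
    Tendsto (fun n => ∫ x, w x * ((ρ n).normed μ ⋆[ContinuousLinearMap.lsmul ℝ ℝ, μ] k) x ∂μ)
      atTop (𝓝 (∫ x, w x * k x ∂μ)) := by
  obtain ⟨C, hC⟩ := hk.bounded_above_of_compact_support hks
  set K : Set E := Metric.closedBall 0 1 + tsupport k
  have hK : IsCompact K := (isCompact_closedBall 0 1).add hks
  have hcont (n : ℕ) : Continuous ((ρ n).normed μ ⋆[ContinuousLinearMap.lsmul ℝ ℝ, μ] k) :=
    hks.continuous_convolution_right _ (ρ n).continuous_normed.locallyIntegrable hk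
  refine tendsto_integral_of_dominated_convergence (K.indicator fun x => ‖w x‖ * (3 * C))
    (fun n => hw.aestronglyMeasurable.mul (hcont n).aestronglyMeasurable) ?_
    (fun n => Eventually.of_forall fun x => ?_) (Eventually.of_forall fun x => ?_)
  · exact (integrable_indicator_iff hK.measurableSet).2
      ((hw.integrableOn_isCompact hK).norm.mul_const _)
  · by_cases hx : x ∈ K
    · rw [indicator_of_mem hx, norm_mul]
      gcongr
      have hdist : dist (((ρ n).normed μ ⋆[ContinuousLinearMap.lsmul ℝ ℝ, μ] k) x) (k x) ≤ 2 * C := by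
        refine ContDiffBump.dist_normed_convolution_le hk.aestronglyMeasurable fun y _ => ?_
        rw [dist_eq_norm]
        linarith [norm_sub_le (k y) (k x), hC y, hC x]
      rw [dist_eq_norm] at hdist
      linarith [norm_le_norm_add_norm_sub' (((ρ n).normed μ ⋆[ContinuousLinearMap.lsmul ℝ ℝ, μ] k) x)
        (k x), hC x]
    · rw [indicator_of_notMem hx, norm_le_zero_iff]
      have h0 : ((ρ n).normed μ ⋆[ContinuousLinearMap.lsmul ℝ ℝ, μ] k) x = 0 := by
        by_contra hne
        refine hx (Set.add_subset_add ?_ (subset_tsupport k) (support_convolution_subset _ hne))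
        rw [(ρ n).support_normed_eq]
        exact Metric.ball_subset_closedBall.trans (Metric.closedBall_subset_closedBall (hρ1 n))
      rw [h0, mul_zero]
  · exact (ContDiffBump.convolution_tendsto_right_of_continuous hρ0 hk x).const_mul _

/-- An integration by parts identity tested against smooth compactly supported functions
extends to `C¹` compactly supported functions. -/
theorem integral_mul_fderiv_eq_neg_of_contDiff_one {c D : E → ℝ} {v : E}
    (hc : LocallyIntegrable c μ) (hD : LocallyIntegrable D μ)
    (hdiv : ∀ ψ : E → ℝ, ContDiff ℝ (⊤ : ℕ∞) ψ → HasCompactSupport ψ →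
      ∫ x, c x * fderiv ℝ ψ x v ∂μ = -∫ x, D x * ψ x ∂μ)
    {g : E → ℝ} (hg : ContDiff ℝ 1 g) (hgs : HasCompactSupport g) :
    ∫ x, c x * fderiv ℝ g x v ∂μ = -∫ x, D x * g x ∂μ := by
  obtain ⟨ρ, hρ1, hρ0⟩ := exists_contDiffBump_rOut_tendsto E
  have hg' : Continuous (fderiv ℝ g) := hg.continuous_fderiv one_ne_zero
  have hl := tendsto_integral_mul_normed_convolution hρ1 hρ0 hc
    (hg'.clm_apply continuous_const) (hgs.fderiv_apply ℝ v)
  have hr := (tendsto_integral_mul_normed_convolution hρ1 hρ0 hD hg.continuous hgs).neg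
  refine tendsto_nhds_unique hl (hr.congr fun n => ?_)
  have hloc : LocallyIntegrable ((ρ n).normed μ) μ := (ρ n).continuous_normed.locallyIntegrable
  rw [← hdiv _ ((ρ n).hasCompactSupport_normed.contDiff_convolution_left _
    (ρ n).contDiff_normed hg.continuous.locallyIntegrable)
    ((ρ n).hasCompactSupport_normed.convolution _ hgs)]
  congr 1 with x
  rw [(hgs.hasFDerivAt_convolution_right _ hloc hg x).fderiv,
    convolution_precompR_apply _ hloc (hgs.fderiv ℝ) hg']

end Mollification

/-- Substitution `y = e s` in the second variable. -/
theorem integral_prod_comp_mul_deriv {X : Type*} [TopologicalSpace X] [MeasurableSpace X]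
    [OpensMeasurableSpace X] [SecondCountableTopology X] [T2Space X] {μ : Measure X} [SFinite μ]
    [IsFiniteMeasureOnCompacts μ]
    (e : ℝ ≃ₜ ℝ) (he : ContDiff ℝ 1 e) (he0 : ∀ s, 0 ≤ deriv e s) {v : X × ℝ → ℝ}
    (hv : Continuous v) (hvs : HasCompactSupport v) :
    ∫ p, v p ∂(μ.prod volume) = ∫ p : X × ℝ, v (p.1, e p.2) * deriv e p.2 ∂(μ.prod volume) := by
  have hc : Continuous fun p : X × ℝ => v (p.1, e p.2) * deriv e p.2 :=
    (hv.comp (by fun_prop)).mul ((he.continuous_deriv le_rfl).comp continuous_snd)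
  have hcs : HasCompactSupport fun p : X × ℝ => v (p.1, e p.2) * deriv e p.2 :=
    (hvs.comp_homeomorph ((Homeomorph.refl X).prodCongr e)).mul_right
  rw [integral_prod _ (hv.integrable_of_hasCompactSupport hvs),
    integral_prod _ (hc.integrable_of_hasCompactSupport hcs)]
  congr 1 with x
  have := integral_image_eq_integral_abs_deriv_smul (f := e) (f' := deriv e) MeasurableSet.univ
    (fun s _ => (he.differentiable one_ne_zero s).hasDerivAt.hasDerivWithinAt)
    e.injective.injOn fun y => v (x, y)
  rw [image_univ, e.surjective.range_eq, setIntegral_univ, setIntegral_univ] at this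
  rw [this]
  congr 1 with s
  rw [abs_of_nonneg (he0 s), smul_eq_mul, mul_comm]

/-- The perturbation `s ↦ e s + ε * s` of an increasing homeomorphism of the line. -/
theorem exists_homeomorph_add_mul (e : ℝ ≃ₜ ℝ) (he : Monotone e) {ε : ℝ} (hε : 0 < ε) :
    ∃ f : ℝ ≃ₜ ℝ, ∀ s, f s = e s + ε * s := by
  have hmono : StrictMono fun s => e s + ε * s :=
    he.add_strictMono fun a b hab => mul_lt_mul_of_pos_left hab hε
  have htop : Tendsto e atTop atTop :=
    he.tendsto_atTop_atTop fun b => ⟨e.symm b, (e.apply_symm_apply b).ge⟩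
  have hbot : Tendsto e atBot atBot :=
    he.tendsto_atBot_atBot fun b => ⟨e.symm b, (e.apply_symm_apply b).le⟩
  have hsurj : Surjective fun s => e s + ε * s :=
    (e.continuous.add (continuous_const.mul continuous_id)).surjective
      (htop.atTop_add_atTop (tendsto_id.const_mul_atTop hε))
      (hbot.atBot_add_atBot (tendsto_id.const_mul_atBot hε))
  exact ⟨(hmono.orderIsoOfSurjective _ hsurj).toHomeomorph, fun s => rfl⟩

theorem tendsto_symm_of_tendsto {e : ℝ ≃ₜ ℝ} (he : StrictMono e) {f : ℕ → ℝ ≃ₜ ℝ}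
    (hf : ∀ n, StrictMono (f n)) (hlim : ∀ s, Tendsto (fun n => f n s) atTop (𝓝 (e s))) (y : ℝ) :
    Tendsto (fun n => (f n).symm y) atTop (𝓝 (e.symm y)) := by
  refine tendsto_order.2 ⟨fun a ha => ?_, fun a ha => ?_⟩
  · have : e a < y := by simpa using he ha
    filter_upwards [(hlim a).eventually_lt_const this] with n hn
    exact (hf n).lt_iff_lt.1 (by simpa using hn)
  · have : y < e a := by simpa using he ha
    filter_upwards [(hlim a).eventually_const_lt this] with n hn
    exact (hf n).lt_iff_lt.1 (by simpa using hn)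

theorem hasDerivAt_comp_prodMk_right {f : ℝ × ℝ → ℝ} (hf : Differentiable ℝ f) (a : ℝ) {γ : ℝ → ℝ}
    {γ' r : ℝ} (hγ : HasDerivAt γ γ' r) :
    HasDerivAt (fun r => f (a, γ r)) (γ' * fderiv ℝ f (a, γ r) (0, 1)) r := by
  have := (hf (a, γ r)).hasFDerivAt.comp_hasDerivAt r ((hasDerivAt_const r a).prodMk hγ)
  have hv : ((0 : ℝ), γ') = γ' • ((0 : ℝ), (1 : ℝ)) := by simp
  rwa [hv, map_smul, smul_eq_mul] at this

section Slice

variable {c D : ℝ × ℝ → ℝ} {W ψ : ℝ × ℝ → ℝ}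

theorem integral_comp_symm_mul_of_diffeomorph (hc : Continuous c) (hD : LocallyIntegrable D)
    (hdiv : ∀ g : ℝ × ℝ → ℝ, ContDiff ℝ 1 g → HasCompactSupport g →
      ∫ x, c x * fderiv ℝ g x (0, 1) = -∫ x, D x * g x)
    (hW : ContDiff ℝ 1 W) (hψ : ContDiff ℝ 1 ψ) (hψs : HasCompactSupport ψ)
    (f : ℝ ≃ₜ ℝ) (hf : ContDiff ℝ 1 f) (hf' : ∀ s, 0 < deriv f s) :
    ∫ x : ℝ × ℝ, W (x.1, f.symm x.2) * (c x * fderiv ℝ ψ x (0, 1) + D x * ψ x)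
      = -∫ p : ℝ × ℝ, c (p.1, f p.2) * ψ (p.1, f p.2) * fderiv ℝ W p (0, 1) := by
  have hsymm : ContDiff ℝ 1 f.symm := f.contDiff_symm_deriv (fun s => (hf' s).ne')
    (fun s => (hf.differentiable one_ne_zero s).hasDerivAt) hf
  set u : ℝ × ℝ → ℝ := fun x => W (x.1, f.symm x.2) with hu_def
  have hu : ContDiff ℝ 1 u := hW.comp (contDiff_fst.prodMk (hsymm.comp contDiff_snd))
  have hu' : Continuous fun x => fderiv ℝ u x (0, 1) :=
    (hu.continuous_fderiv one_ne_zero).clm_apply continuous_const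
  have hψ' : Continuous fun x => fderiv ℝ ψ x (0, 1) :=
    (hψ.continuous_fderiv one_ne_zero).clm_apply continuous_const
  have hv : Continuous fun x => c x * ψ x * fderiv ℝ u x (0, 1) :=
    (hc.mul hψ.continuous).mul hu'
  have hvs : HasCompactSupport fun x => c x * ψ x * fderiv ℝ u x (0, 1) :=
    hψs.mul_left.mul_right
  have hsub := integral_prod_comp_mul_deriv (μ := (volume : Measure ℝ)) f hf
    (fun s => (hf' s).le) hv hvs
  have hchain (p : ℝ × ℝ) : fderiv ℝ u (p.1, f p.2) (0, 1) * deriv f p.2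
      = fderiv ℝ W p (0, 1) := by
    have h1 := hasDerivAt_comp_prodMk_right (hu.differentiable one_ne_zero) p.1
      (hf.differentiable one_ne_zero p.2).hasDerivAt
    have h2 := hasDerivAt_comp_prodMk_right (hW.differentiable one_ne_zero) p.1 (hasDerivAt_id p.2)
    simp only [hu_def, f.symm_apply_apply, id, one_mul] at h1 h2
    rw [mul_comm]
    exact h1.unique h2
  have hprod (x : ℝ × ℝ) : fderiv ℝ (fun x => u x * ψ x) x (0, 1)
      = u x * fderiv ℝ ψ x (0, 1) + ψ x * fderiv ℝ u x (0, 1) := by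
    rw [fderiv_fun_mul (hu.differentiable one_ne_zero x) (hψ.differentiable one_ne_zero x)]
    simp
  have hdivu := hdiv _ (hu.mul hψ) hψs.mul_left
  simp only [hprod] at hdivu
  have hi1 : Integrable fun x => D x * (u x * ψ x) :=
    hD.integrable_smul_right_of_hasCompactSupport (hu.continuous.mul hψ.continuous) hψs.mul_left
  have hi2 : Integrable fun x => c x * (u x * fderiv ℝ ψ x (0, 1)) :=
    (hc.mul (hu.continuous.mul hψ')).integrable_of_hasCompactSupport
      (hψs.fderiv_apply ℝ (0, 1)).mul_left.mul_left
  have hi3 := hv.integrable_of_hasCompactSupport (μ := volume) hvs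
  have e1 : ∫ x, u x * (c x * fderiv ℝ ψ x (0, 1) + D x * ψ x)
      = (∫ x, c x * (u x * fderiv ℝ ψ x (0, 1))) + ∫ x, D x * (u x * ψ x) := by
    rw [← integral_add hi2 hi1]
    congr 1 with x
    ring
  have e2 : ∫ x, c x * (u x * fderiv ℝ ψ x (0, 1) + ψ x * fderiv ℝ u x (0, 1))
      = (∫ x, c x * (u x * fderiv ℝ ψ x (0, 1))) + ∫ x, c x * ψ x * fderiv ℝ u x (0, 1) := by
    rw [← integral_add hi2 hi3]
    congr 1 with x
    ring
  have e3 : ∫ x, c x * ψ x * fderiv ℝ u x (0, 1)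
      = ∫ p : ℝ × ℝ, c (p.1, f p.2) * ψ (p.1, f p.2) * fderiv ℝ W p (0, 1) := by
    refine hsub.trans (integral_congr_ae (Eventually.of_forall fun p => ?_))
    simp only [← hchain p, mul_assoc]
  linarith

theorem integral_comp_symm_mul_of_homeomorph (hc : Continuous c) (hD : LocallyIntegrable D)
    (hdiv : ∀ g : ℝ × ℝ → ℝ, ContDiff ℝ 1 g → HasCompactSupport g →
      ∫ x, c x * fderiv ℝ g x (0, 1) = -∫ x, D x * g x)
    (hW : ContDiff ℝ 1 W) {M : ℝ} (hWM : ∀ x, ‖W x‖ ≤ M)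
    (hψ : ContDiff ℝ 1 ψ) (hψs : HasCompactSupport ψ)
    (e : ℝ ≃ₜ ℝ) (he : ContDiff ℝ 1 e) (hmono : StrictMono e) :
    ∫ x : ℝ × ℝ, W (x.1, e.symm x.2) * (c x * fderiv ℝ ψ x (0, 1) + D x * ψ x)
      = -∫ p : ℝ × ℝ, c (p.1, e p.2) * ψ (p.1, e p.2) * fderiv ℝ W p (0, 1) := by
  have hε (n : ℕ) : (0 : ℝ) < 1 / ((n : ℝ) + 1) := by positivity
  choose f hf using fun n => exists_homeomorph_add_mul e hmono.monotone (hε n)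
  have hfe (n : ℕ) : ⇑(f n) = fun s => e s + 1 / ((n : ℝ) + 1) * s := funext (hf n)
  have hfC (n : ℕ) : ContDiff ℝ 1 (f n) := by
    rw [hfe]; exact he.add (contDiff_const.mul contDiff_id)
  have hf' (n : ℕ) (s : ℝ) : 0 < deriv (f n) s := by
    have h1 := (he.differentiable one_ne_zero s).hasDerivAt.add
      ((hasDerivAt_id s).const_mul (1 / ((n : ℝ) + 1)))
    have h2 : deriv (f n) s = deriv e s + 1 / ((n : ℝ) + 1) * 1 := by
      rw [hfe]; exact h1.deriv
    have := hmono.monotone.deriv_nonneg (x := s)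
    have := hε n
    rw [h2]; linarith
  have hfm (n : ℕ) : StrictMono (f n) := strictMono_of_deriv_pos (hf' n)
  have hlim (s : ℝ) : Tendsto (fun n => f n s) atTop (𝓝 (e s)) := by
    simp only [hf]
    simpa using (tendsto_one_div_add_atTop_nhds_zero_nat.mul_const s).const_add (e s)
  have hsymm := tendsto_symm_of_tendsto hmono hfm hlim
  have hψ' : Continuous fun x => fderiv ℝ ψ x (0, 1) :=
    (hψ.continuous_fderiv one_ne_zero).clm_apply continuous_const
  have hi : Integrable fun x => c x * fderiv ℝ ψ x (0, 1) + D x * ψ x :=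
    ((hc.mul hψ').integrable_of_hasCompactSupport (hψs.fderiv_apply ℝ (0, 1)).mul_left).add
      (hD.integrable_smul_right_of_hasCompactSupport hψ.continuous hψs)
  have hW' : Continuous fun x => fderiv ℝ W x (0, 1) :=
    (hW.continuous_fderiv one_ne_zero).clm_apply continuous_const
  have hG : Continuous fun x => c x * ψ x := hc.mul hψ.continuous
  obtain ⟨C, hC⟩ := hG.bounded_above_of_compact_support hψs.mul_left
  obtain ⟨R, hR⟩ := hψs.isCompact.isBounded.subset_closedBall 0
  set K : Set (ℝ × ℝ) := Metric.closedBall 0 R ×ˢ Icc (min 0 (e.symm (-R))) (max 0 (e.symm R))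
  have hK : IsCompact K := (isCompact_closedBall 0 R).prod isCompact_Icc
  obtain ⟨B, hB⟩ := hK.exists_bound_of_continuousOn hW'.continuousOn
  have hmem (n : ℕ) (p : ℝ × ℝ) (hp : ψ (p.1, f n p.2) ≠ 0) : p ∈ K := by
    have h1 := hR (subset_tsupport ψ hp)
    rw [mem_closedBall_zero_iff, Prod.norm_def, max_le_iff] at h1
    have h2 := abs_le.1 h1.2
    have hfn := hf n p.2
    simp only at h1 h2
    refine ⟨by simpa using h1.1, ?_⟩
    rcases le_total 0 p.2 with h0 | h0
    · refine ⟨(min_le_left _ _).trans h0, le_max_of_le_right ?_⟩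
      rw [← hmono.le_iff_le, e.apply_symm_apply]
      have := mul_nonneg (hε n).le h0
      linarith
    · refine ⟨min_le_of_right_le ?_, h0.trans (le_max_left _ _)⟩
      rw [← hmono.le_iff_le, e.apply_symm_apply]
      have := mul_nonpos_of_nonneg_of_nonpos (hε n).le h0
      linarith
  have hl : Tendsto (fun n => ∫ x : ℝ × ℝ, W (x.1, (f n).symm x.2) *
        (c x * fderiv ℝ ψ x (0, 1) + D x * ψ x)) atTop
      (𝓝 (∫ x : ℝ × ℝ, W (x.1, e.symm x.2) * (c x * fderiv ℝ ψ x (0, 1) + D x * ψ x))) := by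
    refine tendsto_integral_of_dominated_convergence
      (fun x => M * ‖c x * fderiv ℝ ψ x (0, 1) + D x * ψ x‖) (fun n => ?_) (hi.norm.const_mul M)
      (fun n => Eventually.of_forall fun x => ?_) (Eventually.of_forall fun x => ?_)
    · exact (hW.continuous.comp (by fun_prop)).aestronglyMeasurable.mul hi.aestronglyMeasurable
    · rw [norm_mul]
      gcongr
      exact hWM _
    · exact ((hW.continuous.tendsto _).comp
        (tendsto_const_nhds.prodMk_nhds (hsymm x.2))).mul_const _
  have hr : Tendsto (fun n => ∫ p : ℝ × ℝ,
        c (p.1, f n p.2) * ψ (p.1, f n p.2) * fderiv ℝ W p (0, 1)) atTop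
      (𝓝 (∫ p : ℝ × ℝ, c (p.1, e p.2) * ψ (p.1, e p.2) * fderiv ℝ W p (0, 1))) := by
    refine tendsto_integral_of_dominated_convergence (K.indicator fun _ => C * B) (fun n => ?_)
      ?_ (fun n => Eventually.of_forall fun p => ?_) (Eventually.of_forall fun p => ?_)
    · exact ((hG.comp (by fun_prop : Continuous fun p : ℝ × ℝ => (p.1, f n p.2))).mul
        hW').aestronglyMeasurable
    · exact (integrable_indicator_iff hK.measurableSet).2
        (integrableOn_const hK.measure_lt_top.ne)
    · by_cases hp : p ∈ K
      · rw [indicator_of_mem hp, norm_mul]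
        exact mul_le_mul (hC _) (hB p hp) (norm_nonneg _) ((norm_nonneg _).trans (hC 0))
      · rw [indicator_of_notMem hp, not_not.1 (mt (hmem n p) hp)]
        simp
    · exact ((hG.tendsto _).comp
        (tendsto_const_nhds.prodMk_nhds (hlim p.2))).mul_const _
  refine tendsto_nhds_unique hl (hr.neg.congr fun n => ?_)
  exact (integral_comp_symm_mul_of_diffeomorph hc hD hdiv hW hψ hψs (f n) (hfC n) (hf' n)).symm

end Slice

theorem integral_transported_mul_eq {F φ : ℝ → ℝ} {u₀ Dt ψ : ℝ × ℝ → ℝ} (hF : Continuous F)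
    (e : ℝ ≃ₜ ℝ) (he : ContDiff ℝ 1 e) (hmono : StrictMono e) (hode : ∀ s, deriv e s = F (e s))
    (hφ : ContDiff ℝ 1 φ) (hu₀ : ContDiff ℝ 1 u₀) (hu₀s : HasCompactSupport u₀)
    (hD : LocallyIntegrable Dt)
    (hdiv : ∀ g : ℝ × ℝ → ℝ, ContDiff ℝ 1 g → HasCompactSupport g →
      ∫ x, φ x.1 * F x.2 * fderiv ℝ g x (0, 1) = -∫ x, Dt x * g x)
    (hψ : ContDiff ℝ 1 ψ) (hψs : HasCompactSupport ψ) (t : ℝ) :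
    ∫ x : ℝ × ℝ, u₀ (x.1, e (t * φ x.1 + e.symm x.2)) *
        (φ x.1 * F x.2 * fderiv ℝ ψ x (0, 1) + Dt x * ψ x)
      = -∫ x : ℝ × ℝ, F (e (t * φ x.1 + e.symm x.2)) * φ x.1 *
        fderiv ℝ u₀ (x.1, e (t * φ x.1 + e.symm x.2)) (0, 1) * ψ x := by
  have hshift : ContDiff ℝ 1 fun x : ℝ × ℝ => e (t * φ x.1 + x.2) :=
    he.comp ((contDiff_const.mul (hφ.comp contDiff_fst)).add contDiff_snd)
  have hW : ContDiff ℝ 1 fun x : ℝ × ℝ => u₀ (x.1, e (t * φ x.1 + x.2)) :=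
    hu₀.comp (contDiff_fst.prodMk hshift)
  obtain ⟨M, hM⟩ := hu₀.continuous.bounded_above_of_compact_support hu₀s
  have hφc := hφ.continuous
  have hu' : Continuous fun x => fderiv ℝ u₀ x (0, 1) :=
    (hu₀.continuous_fderiv one_ne_zero).clm_apply continuous_const
  have hW' (p : ℝ × ℝ) :
      fderiv ℝ (fun x : ℝ × ℝ => u₀ (x.1, e (t * φ x.1 + x.2))) p (0, 1)
        = F (e (t * φ p.1 + p.2)) * fderiv ℝ u₀ (p.1, e (t * φ p.1 + p.2)) (0, 1) := by
    have h1 := hasDerivAt_comp_prodMk_right (hW.differentiable one_ne_zero) p.1 (hasDerivAt_id p.2)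
    have h2 := hasDerivAt_comp_prodMk_right (hu₀.differentiable one_ne_zero) p.1
      ((he.differentiable one_ne_zero (t * φ p.1 + p.2)).hasDerivAt.comp_const_add (t * φ p.1) p.2)
    rw [one_mul] at h1
    rw [← hode]
    exact h1.unique h2
  rw [integral_comp_symm_mul_of_homeomorph (c := fun x => φ x.1 * F x.2)
    ((hφc.comp continuous_fst).mul (hF.comp continuous_snd)) hD hdiv hW (fun x => hM _) hψ hψs e he
    hmono]
  have hpt : Continuous fun x : ℝ × ℝ => (x.1, e (t * φ x.1 + e.symm x.2)) := by fun_prop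
  have hsub := integral_prod_comp_mul_deriv (μ := (volume : Measure ℝ)) e he
    (fun s => hmono.monotone.deriv_nonneg)
    (v := fun x => F (e (t * φ x.1 + e.symm x.2)) * φ x.1 *
        fderiv ℝ u₀ (x.1, e (t * φ x.1 + e.symm x.2)) (0, 1) * ψ x)
    ((((hF.comp (continuous_snd.comp hpt)).mul (hφc.comp continuous_fst)).mul
      (hu'.comp hpt)).mul hψ.continuous) hψs.mul_left
  rw [← Measure.volume_eq_prod] at hsub
  rw [hsub]
  congr 2 with p
  rw [hW', hode, e.symm_apply_apply]
  ring

/-- In the DiPerna–Lions-type example, the composition of the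
initial datum with the flow generated by any C¹ homeomorphism h with h' = F∘h is a
bounded distributional solution of ∂ₜu − b̃·∇u = 0 with u(0,·) = u₀, where
b̃(x₁,x₂) = (0, φ(x₁)F(x₂)) and D̃ is the distributional divergence of b̃. -/
theorem composition_with_flow_is_weak_solution
    (T : ℝ) (hT : 0 < T)
    (F : ℝ → ℝ) (hFc : Continuous F) (hFb : ∃ C : ℝ, ∀ y, |F y| ≤ C)
    (hFpos : ∀ y, 0 ≤ F y)
    (h hinv : ℝ → ℝ) (hC1 : ContDiff ℝ 1 h)
    (hleft : LeftInverse hinv h) (hright : RightInverse hinv h)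
    (hinvcont : Continuous hinv)
    (hode : ∀ s, deriv h s = F (h s))
    (φ : ℝ → ℝ) (hφ : ContDiff ℝ (⊤ : ℕ∞) φ) (hφsupp : HasCompactSupport φ)
    (u₀ : ℝ × ℝ → ℝ) (hu₀ : ContDiff ℝ (⊤ : ℕ∞) u₀) (hu₀supp : HasCompactSupport u₀)
    (Dt : ℝ × ℝ → ℝ) (hDloc : LocallyIntegrable Dt volume)
    (hDdiv : ∀ ψ : ℝ × ℝ → ℝ, ContDiff ℝ (⊤ : ℕ∞) ψ → HasCompactSupport ψ →
      (∫ x : ℝ × ℝ, dotGrad2 (0, φ x.1 * F x.2) ψ x) = -∫ x : ℝ × ℝ, Dt x * ψ x) :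
    (Measurable (uncurry (fun t (x : ℝ × ℝ) => u₀ (x.1, h (t * φ x.1 + hinv x.2)))) ∧
      ∃ M : ℝ, ∀ᵐ (p : ℝ × (ℝ × ℝ)) ∂volume, p.1 ∈ Ioo 0 T →
        |u₀ (p.2.1, h (p.1 * φ p.2.1 + hinv p.2.2))| ≤ M) ∧
    ∀ ψ : ℝ → ℝ × ℝ → ℝ, ContDiff ℝ (⊤ : ℕ∞) (uncurry ψ) → HasCompactSupport (uncurry ψ) →
      tsupport (uncurry ψ) ⊆ Ico 0 T ×ˢ (univ : Set (ℝ × ℝ)) →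
      (-(∫ t in Ioo 0 T, ∫ x : ℝ × ℝ,
            u₀ (x.1, h (t * φ x.1 + hinv x.2)) * deriv (fun s => ψ s x) t)
        - (∫ x : ℝ × ℝ, u₀ x * ψ 0 x)
        + (∫ t in Ioo 0 T, ∫ x : ℝ × ℝ,
            u₀ (x.1, h (t * φ x.1 + hinv x.2)) *
              (dotGrad2 (0, φ x.1 * F x.2) (ψ t) x + Dt x * ψ t x))) = 0 := by
  have hmono : StrictMono h :=
    (monotone_of_deriv_nonneg (hC1.differentiable one_ne_zero)
      fun s => (hode s).symm ▸ hFpos _).strictMono_of_injective hleft.injective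
  let e : ℝ ≃ₜ ℝ := ⟨⟨h, hinv, hleft, hright⟩, hC1.continuous, hinvcont⟩
  have hhc := hC1.continuous
  have hφc := hφ.continuous
  have hu₁ : ContDiff ℝ 1 u₀ := hu₀.of_le (by exact_mod_cast le_top)
  have hu' : Continuous fun x => fderiv ℝ u₀ x (0, 1) :=
    (hu₁.continuous_fderiv one_ne_zero).clm_apply continuous_const
  have hpt : Continuous fun p : ℝ × (ℝ × ℝ) => (p.2.1, h (p.1 * φ p.2.1 + hinv p.2.2)) := by
    fun_prop
  have hU : Continuous fun p : ℝ × (ℝ × ℝ) => u₀ (p.2.1, h (p.1 * φ p.2.1 + hinv p.2.2)) :=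
    hu₀.continuous.comp hpt
  obtain ⟨M, hM⟩ := hu₀.continuous.bounded_above_of_compact_support hu₀supp
  refine ⟨⟨hU.measurable, M, Eventually.of_forall fun p _ => hM _⟩, fun ψ hψ hψs hψT => ?_⟩
  have hψ₁ : ContDiff ℝ 1 (uncurry ψ) := hψ.of_le (by exact_mod_cast le_top)
  have hdiv : ∀ g : ℝ × ℝ → ℝ, ContDiff ℝ 1 g → HasCompactSupport g →
      ∫ x, φ x.1 * F x.2 * fderiv ℝ g x (0, 1) = -∫ x, Dt x * g x := by
    intro g hg hgs
    refine integral_mul_fderiv_eq_neg_of_contDiff_one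
      ((hφc.comp continuous_fst).mul (hFc.comp continuous_snd)).locallyIntegrable hDloc
      (fun χ hχ hχs => ?_) hg hgs
    simpa [dotGrad2] using hDdiv χ hχ hχs
  have hslice (t : ℝ) : ContDiff ℝ 1 (ψ t) := hψ₁.comp (contDiff_prodMk_right t)
  have hslices (t : ℝ) : HasCompactSupport (ψ t) :=
    hψs.comp_isClosedEmbedding 
      (LeftInverse.isClosedEmbedding (f := Prod.snd) (fun _ => rfl) continuous_snd
        (Continuous.prodMk_right t))
  have hzero {t : ℝ} (ht : t ∉ Ico 0 T) (x : ℝ × ℝ) : uncurry ψ =ᶠ[𝓝 (t, x)] 0 :=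
    notMem_tsupport_iff_eventuallyEq.1 fun hmem => ht (hψT hmem).1
  have hψt (t : ℝ) (x : ℝ × ℝ) :
      HasDerivAt (fun s => ψ s x) (fderiv ℝ (uncurry ψ) (t, x) (1, 0)) t :=
    HasFDerivAt.comp_hasDerivAt (f := fun s => (s, x)) t
      (hψ₁.differentiable one_ne_zero (t, x)).hasFDerivAt
      ((hasDerivAt_id t).prodMk (hasDerivAt_const t x))
  have hψ0 (x : ℝ × ℝ) : ψ 0 x = 0 := by
    have hcont : Continuous fun t => ψ t x := hψ₁.continuous.comp (Continuous.prodMk_left x)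
    have hcl : closure (Iio (0 : ℝ)) ⊆ {t | ψ t x = 0} :=
      closure_minimal (fun t ht => (hzero (fun hmem => hmem.1.not_gt ht) x).eq_of_nhds)
        (isClosed_eq hcont continuous_const)
    rw [closure_Iio] at hcl
    exact hcl self_mem_Iic
  have hdt : Continuous fun p => fderiv ℝ (uncurry ψ) p (1, 0) :=
    (hψ₁.continuous_fderiv one_ne_zero).clm_apply continuous_const
  set w : ℝ × (ℝ × ℝ) → ℝ := fun p => F (h (p.1 * φ p.2.1 + hinv p.2.2)) * φ p.2.1 *
    fderiv ℝ u₀ (p.2.1, h (p.1 * φ p.2.1 + hinv p.2.2)) (0, 1) with hw_def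
  have hw : Continuous w :=
    ((hFc.comp (continuous_snd.comp hpt)).mul (hφc.comp (by fun_prop))).mul (hu'.comp hpt)
  have hUt (t : ℝ) (x : ℝ × ℝ) :
      HasDerivAt (fun s => u₀ (x.1, h (s * φ x.1 + hinv x.2))) (w (t, x)) t := by
    have hγ : HasDerivAt (fun s => h (s * φ x.1 + hinv x.2))
        (F (h (t * φ x.1 + hinv x.2)) * (1 * φ x.1)) t := by
      rw [← hode]
      exact (hC1.differentiable one_ne_zero _).hasDerivAt.comp t
        (((hasDerivAt_id t).mul_const (φ x.1)).add_const (hinv x.2))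
    have := hasDerivAt_comp_prodMk_right (hu₁.differentiable one_ne_zero) x.1 hγ
    rwa [one_mul] at this
  have hwψ : Continuous (uncurry fun t x => w (t, x) * ψ t x) := hw.mul hψ₁.continuous
  have hwψs : HasCompactSupport (uncurry fun t x => w (t, x) * ψ t x) := hψs.mul_left
  have hUψ : Continuous (uncurry fun t (x : ℝ × ℝ) =>
      u₀ (x.1, h (t * φ x.1 + hinv x.2)) * fderiv ℝ (uncurry ψ) (t, x) (1, 0)) := hU.mul hdt
  have hUψs : HasCompactSupport (uncurry fun t (x : ℝ × ℝ) =>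
      u₀ (x.1, h (t * φ x.1 + hinv x.2)) * fderiv ℝ (uncurry ψ) (t, x) (1, 0)) :=
    (hψs.fderiv_apply ℝ (1, 0)).mul_left
  have hparts (x : ℝ × ℝ) : ∫ t, u₀ (x.1, h (t * φ x.1 + hinv x.2)) *
      fderiv ℝ (uncurry ψ) (t, x) (1, 0) = -∫ t, w (t, x) * ψ t x := by
    have hx : Continuous fun t : ℝ => (t, x) := Continuous.prodMk_left x
    have hemb : IsClosedEmbedding fun t : ℝ => (t, x) :=
      LeftInverse.isClosedEmbedding (f := Prod.fst) (fun _ => rfl) continuous_fst hx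
    exact integral_mul_deriv_eq_deriv_mul_of_integrable (fun t _ => hUt t x) (fun t _ => hψt t x)
      ((hUψ.comp hx).integrable_of_hasCompactSupport (hUψs.comp_isClosedEmbedding hemb))
      ((hwψ.comp hx).integrable_of_hasCompactSupport (hwψs.comp_isClosedEmbedding hemb))
      (((hU.comp hx).mul (hψ₁.continuous.comp hx)).integrable_of_hasCompactSupport
        (hψs.comp_isClosedEmbedding hemb).mul_left)
  have htime : ∫ t in Ioo 0 T, ∫ x : ℝ × ℝ,
      u₀ (x.1, h (t * φ x.1 + hinv x.2)) * deriv (fun s => ψ s x) t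
        = -∫ x, ∫ t, w (t, x) * ψ t x := by
    simp only [fun t x => (hψt t x).deriv]
    rw [← integral_Ico_eq_integral_Ioo, setIntegral_eq_integral_of_forall_compl_eq_zero,
      integral_integral_swap_of_hasCompactSupport hUψ hUψs]
    · simp only [hparts, integral_neg]
    · intro t ht
      have hd (x : ℝ × ℝ) : fderiv ℝ (uncurry ψ) (t, x) = 0 := by
        rw [(hzero ht x).fderiv_eq, fderiv_zero, Pi.zero_apply]
      simp [hd]
  have hspace : ∫ t in Ioo 0 T, ∫ x : ℝ × ℝ, u₀ (x.1, h (t * φ x.1 + hinv x.2)) *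
      (dotGrad2 (0, φ x.1 * F x.2) (ψ t) x + Dt x * ψ t x)
        = -∫ x, ∫ t, w (t, x) * ψ t x := by
    have hfix (t : ℝ) : ∫ x : ℝ × ℝ, u₀ (x.1, h (t * φ x.1 + hinv x.2)) *
        (dotGrad2 (0, φ x.1 * F x.2) (ψ t) x + Dt x * ψ t x) = -∫ x, w (t, x) * ψ t x := by
      simp only [dotGrad2, zero_mul, zero_add]
      exact integral_transported_mul_eq hFc e hC1 hmono hode (hφ.of_le (by exact_mod_cast le_top))
        hu₁ hu₀supp hDloc hdiv (hslice t) (hslices t) t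
    simp only [hfix]
    rw [← integral_Ico_eq_integral_Ioo, setIntegral_eq_integral_of_forall_compl_eq_zero,
      integral_neg, integral_integral_swap_of_hasCompactSupport hwψ hwψs]
    intro t ht
    simp [fun x => show ψ t x = 0 from (hzero ht x).eq_of_nhds]
  rw [htime, hspace]
  simp [hψ0]
end
end
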